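/- The complex B^3_9 is a 3-pseudomanifold on 9 vertices which is not neighbourly (the pair {7,9} is its only non-edge) and which admits no proper bistellar move: B^3_9 has no removable 1-face and no removable 2-face. -/

import Mathlib

/-! Basic framework for finite simplicial complexes, pseudomanifolds and
bistellar moves, following Datta–Nilakantan. A complex is recorded as the
finite set of its faces (nonempty finite subsets of the vertex type). -/

namespace NPM

variable {α β : Type*} [DecidableEq α] [DecidableEq β]

/-- A "complex" datum: a finite family of finite subsets of `α`. -/
abbrev Complex (α : Type*) := Finset (Finset α)

/-- `K` is a simplicial complex: a nonempty collection of nonempty sets,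
closed under passing to nonempty subsets. -/
def IsComplex (K : Complex α) : Prop :=
  K.Nonempty ∧ (∀ σ ∈ K, σ.Nonempty) ∧ ∀ σ ∈ K, ∀ τ ⊆ σ, τ.Nonempty → τ ∈ K

/-- The vertex set of `K`. -/
def verts (K : Complex α) : Finset α := K.sup id

/-- `K` is pure of dimension `d`: every face is contained in a face with
`d+1` vertices. -/
def IsPure (K : Complex α) (d : ℕ) : Prop :=
  ∀ σ ∈ K, ∃ τ ∈ K, σ ⊆ τ ∧ τ.card = d + 1

/-- The facets ("`d`-faces") of a pure `d`-dimensional complex. -/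
def facets (K : Complex α) (d : ℕ) : Complex α := K.filter (fun σ => σ.card = d + 1)

/-- The link of a face `σ` in `K`. -/
def link (K : Complex α) (σ : Finset α) : Complex α :=
  K.filter (fun τ => Disjoint τ σ ∧ σ ∪ τ ∈ K)

/-- The degree of a face: the number of vertices of its link. -/
def degree (K : Complex α) (σ : Finset α) : ℕ := (verts (link K σ)).card

/-- A weak `d`-pseudomanifold: a pure `d`-dimensional complex in which every
`(d-1)`-face (i.e. face with `d` vertices) lies in exactly two facets. -/
def WeakPM (K : Complex α) (d : ℕ) : Prop :=
  IsComplex K ∧ IsPure K d ∧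
    ∀ σ ∈ K, σ.card = d → (K.filter fun τ => σ ⊆ τ ∧ τ.card = d + 1).card = 2

/-- Strong connectedness: any two facets are joined by a chain of facets in
which consecutive facets meet in a `(d-1)`-face. -/
def SConn (K : Complex α) (d : ℕ) : Prop :=
  ∀ σ ∈ facets K d, ∀ τ ∈ facets K d,
    Relation.ReflTransGen
      (fun a b => a ∈ facets K d ∧ b ∈ facets K d ∧ (a ∩ b).card = d) σ τ

/-- A `d`-pseudomanifold: a strongly connected weak `d`-pseudomanifold. -/
def IsPM (K : Complex α) (d : ℕ) : Prop := WeakPM K d ∧ SConn K d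

/-- Connectedness of a complex: the graph of vertices and edges is connected. -/
def Conn (K : Complex α) : Prop :=
  (verts K).Nonempty ∧ ∀ u ∈ verts K, ∀ v ∈ verts K,
    Relation.ReflTransGen (fun a b => a ≠ b ∧ ({a, b} : Finset α) ∈ K) u v

/-- A normal `d`-pseudomanifold: a connected weak `d`-pseudomanifold in which
the link of every face of dimension `≤ d - 2` is connected. -/
def NormalPM (K : Complex α) (d : ℕ) : Prop :=
  WeakPM K d ∧ Conn K ∧ ∀ σ ∈ K, σ.card + 1 ≤ d → Conn (link K σ)

/-- `K` is neighbourly: every pair of vertices forms an edge. -/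
def Neighbourly (K : Complex α) : Prop :=
  ∀ u ∈ verts K, ∀ v ∈ verts K, u ≠ v → ({u, v} : Finset α) ∈ K

/-- Isomorphism of complexes: a map injective on the vertex set carrying the
faces of `K` exactly onto the faces of `L`. -/
def Iso (K : Complex α) (L : Complex β) : Prop :=
  ∃ f : α → β, Set.InjOn f ↑(verts K) ∧ L = K.image (fun σ => σ.image f)

/-- The complex generated by a family of facets: all nonempty subsets. -/
def genCx (F : Finset (Finset α)) : Complex α :=
  F.biUnion fun σ => σ.powerset.filter (fun τ => τ.Nonempty)

/-- The standard sphere on the vertex set `B`: all nonempty proper subsets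
of `B`. -/
def stdSphere (B : Finset α) : Complex α :=
  B.powerset.filter fun τ => τ.Nonempty ∧ τ ≠ B

/-- In a weak `d`-pseudomanifold, a removable `(d-i)`-face `A`: its link is a
standard sphere `S^{i-1}_{i+1}(B)` with `B` not a face.  (For `d = 3`,
`i = 1` gives removable 2-faces and `i = 2` gives removable 1-faces.) -/
def RemovableFace (d i : ℕ) (K : Complex α) (A : Finset α) : Prop :=
  A ∈ K ∧ A.card = d - i + 1 ∧
    ∃ B : Finset α, B.card = i + 1 ∧ B ∉ K ∧ link K A = stdSphere B

/-- The bistellar `i`-move (`0 < i ≤ d`) relation on weak `d`-pseudomanifolds: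
`L` is obtained from `K` by removing a removable `(d-i)`-face `A` with
`link K A = stdSphere B` and inserting the facets `(B ∪ A) \ {v}`, `v ∈ A`. -/
def BMove (d i : ℕ) (K L : Complex α) : Prop :=
  ∃ A B : Finset α, A ∈ K ∧ A.card = d - i + 1 ∧ B.card = i + 1 ∧ B ∉ K ∧
    link K A = stdSphere B ∧
    L = genCx ((facets K d).filter (fun σ => ¬ A ⊆ σ) ∪
          A.image fun v => (B ∪ A).erase v)

/-- The bistellar `0`-move: star a new vertex `w` in a facet `σ`. -/
def BMove0 (d : ℕ) (K L : Complex α) : Prop :=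
  ∃ σ w, σ ∈ K ∧ σ.card = d + 1 ∧ w ∉ verts K ∧
    L = genCx (((facets K d).erase σ) ∪ σ.image fun v => insert w (σ.erase v))

/-- A single bistellar move of any type `0 ≤ i ≤ d`. -/
def BStep (d : ℕ) (K L : Complex α) : Prop :=
  BMove0 d K L ∨ ∃ i, 0 < i ∧ i ≤ d ∧ BMove d i K L

/-- Bistellar equivalence: a finite sequence of bistellar moves. -/
def BEquiv (d : ℕ) : Complex α → Complex α → Prop :=
  Relation.ReflTransGen (BStep d)

/-- A proper bistellar move: a bistellar `i`-move with `0 < i < d`. -/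
def PMove (d : ℕ) (K L : Complex α) : Prop := ∃ i, 0 < i ∧ i < d ∧ BMove d i K L

/-- Proper bistellar equivalence. -/
def PEquiv (d : ℕ) : Complex α → Complex α → Prop :=
  Relation.ReflTransGen (PMove d)

/-- The result of the bistellar move on the face `A` of the weak
`d`-pseudomanifold `K` (deterministic form: `B` is the vertex set of
`link K A`). -/
def kappa (d : ℕ) (K : Complex α) (A : Finset α) : Complex α :=
  genCx ((facets K d).filter (fun σ => ¬ A ⊆ σ) ∪
    A.image fun v => (verts (link K A) ∪ A).erase v)

/-- A cycle: a (finite) 1-pseudomanifold. -/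
def Cycle (K : Complex α) : Prop := IsPM K 1

/-- A combinatorial 2-manifold: a weak 2-pseudomanifold all whose vertex
links are cycles. -/
def Comb2Mfd (K : Complex α) : Prop :=
  WeakPM K 2 ∧ ∀ v, ({v} : Finset α) ∈ K → Cycle (link K {v})

/-- The Euler characteristic `f₀ - f₁ + f₂` of a 2-dimensional complex. -/
def eulerChar (K : Complex α) : ℤ :=
  ((K.filter fun σ => σ.card = 1).card : ℤ) -
    ((K.filter fun σ => σ.card = 2).card : ℤ) +
    ((K.filter fun σ => σ.card = 3).card : ℤ)

/-- A combinatorial 2-sphere: a connected combinatorial 2-manifold with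
Euler characteristic 2. -/
def Comb2Sphere (K : Complex α) : Prop := Comb2Mfd K ∧ Conn K ∧ eulerChar K = 2

/-- A combinatorial 3-manifold: a 3-pseudomanifold all whose vertex links are
combinatorial 2-spheres. -/
def Comb3Mfd (K : Complex α) : Prop :=
  IsPM K 3 ∧ ∀ v, ({v} : Finset α) ∈ K → Comb2Sphere (link K {v})

end NPM

/-- The complex `N3` from the paper, generated by its facets. -/
def N3 : NPM.Complex ℕ :=
  NPM.genCx {{1,2,4,8}, {1,2,6,8}, {1,3,4,8}, {1,3,7,8}, {1,5,6,8}, {1,5,7,8}, {2,3,5,8}, {2,3,7,8}, {2,4,5,8}, {2,6,7,8}, {3,4,6,8}, {3,5,6,8}, {4,5,7,8}, {4,6,7,8}, {1,2,3,4}, {2,3,4,7}, {2,4,5,6}, {2,4,6,7}, {3,4,5,6}, {3,4,5,7}, {1,2,3,5}, {1,2,5,6}, {1,3,5,7}}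

/-- The complex `B^3_9`: replace the facets `1248` and `3568` of `N_3` by the
eight facets obtained from starring and identifying, as in the paper. -/
def B39 : NPM.Complex ℕ :=
  NPM.genCx ((NPM.facets N3 3 \ {{1,2,4,8}, {3,5,6,8}}) ∪
    {{1,2,4,9}, {1,2,8,9}, {1,4,8,9}, {2,4,8,9},
     {3,5,6,9}, {3,5,8,9}, {3,6,8,9}, {5,6,8,9}})

namespace NPM

variable {α : Type*} [DecidableEq α]

lemma mem_genCx {F : Complex α} {σ : Finset α} :
    σ ∈ genCx F ↔ σ.Nonempty ∧ ∃ τ ∈ F, σ ⊆ τ := by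
  simp only [genCx, Finset.mem_biUnion, Finset.mem_filter, Finset.mem_powerset]
  tauto

lemma mem_verts {K : Complex α} {v : α} : v ∈ verts K ↔ ∃ σ ∈ K, v ∈ σ := by
  simp [verts, Finset.mem_sup]

lemma facets_genCx {F : Complex α} {d : ℕ} (hF : ∀ σ ∈ F, σ.card = d + 1) :
    facets (genCx F) d = F := by
  ext σ
  simp only [facets, Finset.mem_filter, mem_genCx]
  constructor
  · rintro ⟨⟨-, τ, hτ, hle⟩, hc⟩
    rwa [Finset.eq_of_subset_of_card_le hle (by rw [hc, hF τ hτ])]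
  · intro h
    exact ⟨⟨Finset.card_pos.1 (by rw [hF σ h]; omega), σ, h, subset_rfl⟩, hF σ h⟩

lemma verts_genCx (F : Complex α) : verts (genCx F) = F.sup id := by
  ext v
  simp only [mem_verts, mem_genCx, Finset.mem_sup, id]
  constructor
  · rintro ⟨σ, ⟨-, τ, hτ, hle⟩, hv⟩
    exact ⟨τ, hτ, hle hv⟩
  · rintro ⟨τ, hτ, hv⟩
    exact ⟨τ, ⟨⟨v, hv⟩, τ, hτ, subset_rfl⟩, hv⟩

/-- A nonempty family of `(d+1)`-sets generates a weak `d`-pseudomanifold as soon as every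
`d`-subset of a member lies in exactly two members. -/
lemma weakPM_genCx {F : Complex α} {d : ℕ} (hne : F.Nonempty)
    (hF : ∀ σ ∈ F, σ.card = d + 1)
    (hridge : ∀ τ ∈ F, ∀ σ ∈ τ.powersetCard d, (F.filter (σ ⊆ ·)).card = 2) :
    WeakPM (genCx F) d := by
  have hmem : ∀ σ ∈ F, σ ∈ genCx F := fun σ h =>
    mem_genCx.2 ⟨Finset.card_pos.1 (by rw [hF σ h]; omega), σ, h, subset_rfl⟩
  refine ⟨⟨hne.mono hmem, fun σ h => (mem_genCx.1 h).1, fun σ h τ hτ hn => ?_⟩,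
    fun σ h => ?_, fun σ h hc => ?_⟩
  · obtain ⟨-, ρ, hρ, hle⟩ := mem_genCx.1 h
    exact mem_genCx.2 ⟨hn, ρ, hρ, hτ.trans hle⟩
  · obtain ⟨-, ρ, hρ, hle⟩ := mem_genCx.1 h
    exact ⟨ρ, hmem ρ hρ, hle, hF ρ hρ⟩
  · obtain ⟨-, ρ, hρ, hle⟩ := mem_genCx.1 h
    rw [← hridge ρ hρ σ (Finset.mem_powersetCard.2 ⟨hle, hc⟩)]
    congr 1
    conv_rhs => rw [← facets_genCx hF, facets, Finset.filter_filter]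
    simp only [and_comm]

/-- A complex is strongly connected if its facets can be listed so that each one after the
first meets an earlier one in a `(d-1)`-face. -/
lemma sconn_of_list {K : Complex α} {d : ℕ} (l : List (Finset α))
    (hl : facets K d = l.toFinset)
    (hstep : ∀ i : Fin l.length, i.val ≠ 0 → ∃ j : Fin l.length, j < i ∧
      (l.get j ∩ l.get i).card = d) :
    SConn K d := by
  have hmem : ∀ i, l.get i ∈ facets K d := fun i => by
    rw [hl, List.mem_toFinset]
    exact List.get_mem l i
  have hsymm : Std.Symm (fun a b : Finset α =>
      a ∈ facets K d ∧ b ∈ facets K d ∧ (a ∩ b).card = d) :=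
    ⟨fun a b ⟨ha, hb, h⟩ => ⟨hb, ha, by rwa [Finset.inter_comm]⟩⟩
  have key : ∀ n (h : n < l.length), Relation.ReflTransGen
      (fun a b => a ∈ facets K d ∧ b ∈ facets K d ∧ (a ∩ b).card = d)
      (l.get ⟨0, by omega⟩) (l.get ⟨n, h⟩) := by
    intro n
    induction n using Nat.strong_induction_on with
    | _ n ih =>
      intro h
      rcases eq_or_ne n 0 with rfl | hn
      · exact .refl
      · obtain ⟨j, hj, hc⟩ := hstep ⟨n, h⟩ hn
        exact (ih j hj j.2).tail ⟨hmem _, hmem _, hc⟩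
  intro σ hσ τ hτ
  rw [hl, List.mem_toFinset] at hσ hτ
  obtain ⟨i, rfl⟩ := List.mem_iff_get.1 hσ
  obtain ⟨j, rfl⟩ := List.mem_iff_get.1 hτ
  exact (Relation.ReflTransGen.stdSymm.symm _ _ (key i i.2)).trans (key j j.2)

/-- The core `B` of a removable face `A` is the vertex set of the link of `A`, hence is
determined by the facets containing `A`. -/
lemma RemovableFace.core_not_mem {F : Complex α} {d i : ℕ} (hi : 0 < i) {A : Finset α}
    (h : RemovableFace d i (genCx F) A) :
    (∃ τ ∈ F, A ∈ τ.powersetCard (d - i + 1)) ∧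
      ((F.filter (A ⊆ ·)).sup id \ A).card = i + 1 ∧
      ∀ τ ∈ F, ¬ (F.filter (A ⊆ ·)).sup id \ A ⊆ τ := by
  obtain ⟨hA, hAc, B, hBc, hB, hlink⟩ := h
  obtain ⟨-, τ, hτ, hle⟩ := mem_genCx.1 hA
  have hV : (F.filter (A ⊆ ·)).sup id \ A = B := by
    ext v
    have h1 : {v} ∈ link (genCx F) A ↔ v ∈ (F.filter (A ⊆ ·)).sup id \ A := by
      simp only [link, Finset.mem_filter, mem_genCx, Finset.disjoint_singleton_left,
        Finset.mem_sdiff, Finset.mem_sup, id, Finset.union_subset_iff,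
        Finset.singleton_subset_iff]
      constructor
      · rintro ⟨-, hv, -, ρ, hρ, hAρ, hvρ⟩
        exact ⟨⟨ρ, ⟨hρ, hAρ⟩, hvρ⟩, hv⟩
      · rintro ⟨⟨ρ, ⟨hρ, hAρ⟩, hvρ⟩, hv⟩
        exact ⟨⟨Finset.singleton_nonempty v, ρ, hρ, hvρ⟩, hv,
          ⟨v, by simp⟩, ρ, hρ, hAρ, hvρ⟩
    rw [← h1, hlink]
    simp only [stdSphere, Finset.mem_filter, Finset.mem_powerset,
      Finset.singleton_subset_iff, Finset.singleton_nonempty, true_and, and_iff_left_iff_imp]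
    rintro - rfl
    rw [Finset.card_singleton] at hBc
    omega
  rw [hV]
  refine ⟨⟨τ, hτ, Finset.mem_powersetCard.2 ⟨hle, hAc⟩⟩, hBc, fun ρ hρ hBρ => hB ?_⟩
  exact mem_genCx.2 ⟨Finset.card_pos.1 (by omega), ρ, hρ, hBρ⟩

end NPM

/-- The facets of `B39`, listed so that each one after the first is adjacent to an earlier
one. -/
def facetsB39 : List (Finset ℕ) :=
  [ {1,2,6,8}, {1,5,6,8}, {1,5,7,8}, {1,3,7,8}, {1,3,4,8}, {2,3,7,8}, {2,3,5,8}, {2,4,5,8},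
    {2,6,7,8}, {3,4,6,8}, {4,5,7,8}, {4,6,7,8}, {1,2,3,4}, {2,3,4,7}, {2,4,5,6}, {2,4,6,7},
    {3,4,5,6}, {3,4,5,7}, {1,2,3,5}, {1,2,5,6}, {1,3,5,7}, {1,2,4,9}, {1,2,8,9}, {1,4,8,9},
    {2,4,8,9}, {3,5,6,9}, {3,5,8,9}, {3,6,8,9}, {5,6,8,9}]

lemma B39_eq_genCx : B39 = NPM.genCx facetsB39.toFinset := by
  rw [B39, N3, NPM.facets_genCx (by decide +kernel)]
  congr 1
  decide +kernel

lemma card_of_mem_facetsB39 : ∀ σ ∈ facetsB39.toFinset, σ.card = 3 + 1 := by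
  decide +kernel

lemma verts_B39 : NPM.verts B39 = Finset.Icc 1 9 := by
  rw [B39_eq_genCx, NPM.verts_genCx]
  decide +kernel

lemma pair_mem_B39 {u v : ℕ} :
    ({u, v} : Finset ℕ) ∈ B39 ↔ ∃ τ ∈ facetsB39.toFinset, {u, v} ⊆ τ := by
  rw [B39_eq_genCx, NPM.mem_genCx, and_iff_right (Finset.insert_nonempty u {v})]

lemma isPM_B39 : NPM.IsPM B39 3 := by
  rw [B39_eq_genCx]
  refine ⟨NPM.weakPM_genCx (by decide +kernel) card_of_mem_facetsB39 (by decide +kernel), ?_⟩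
  exact NPM.sconn_of_list facetsB39 (NPM.facets_genCx card_of_mem_facetsB39) (by decide +kernel)

lemma pair_notMem_B39_iff : ∀ u ∈ NPM.verts B39, ∀ v ∈ NPM.verts B39, u ≠ v →
    (({u, v} : Finset ℕ) ∉ B39 ↔ ({u, v} : Finset ℕ) = {7, 9}) := by
  simp only [pair_mem_B39, verts_B39]
  decide +kernel

lemma not_neighbourly_B39 : ¬ NPM.Neighbourly B39 := by
  have hpair : ({7, 9} : Finset ℕ) ∉ B39 := by
    rw [pair_mem_B39]
    decide +kernel
  have hverts := verts_B39
  generalize B39 = K at hpair hverts ⊢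
  intro h
  exact hpair (h 7 (by simp [hverts]) 9 (by simp [hverts]) (by simp))

lemma core_subset_facet_B39 :
    ∀ i ∈ Finset.Ioo 0 3, ∀ τ ∈ facetsB39.toFinset, ∀ A ∈ τ.powersetCard (3 - i + 1),
      ((facetsB39.toFinset.filter (A ⊆ ·)).sup id \ A).card = i + 1 →
      ∃ ρ ∈ facetsB39.toFinset, (facetsB39.toFinset.filter (A ⊆ ·)).sup id \ A ⊆ ρ := by
  decide +kernel

lemma not_removableFace_B39 {i : ℕ} (hi : 0 < i) (hi3 : i < 3) (A : Finset ℕ) :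
    ¬ NPM.RemovableFace 3 i B39 A := by
  rw [B39_eq_genCx]
  intro h
  obtain ⟨⟨τ, hτ, hA⟩, hcard, hcore⟩ := h.core_not_mem hi
  obtain ⟨ρ, hρ, hle⟩ :=
    core_subset_facet_B39 i (Finset.mem_Ioo.2 ⟨hi, hi3⟩) τ hτ A hA hcard
  exact hcore ρ hρ hle

/-- `B^3_9` is a 9-vertex 3-pseudomanifold, not neighbourly
(`{7,9}` is its only non-edge), admitting no proper bistellar move (no
removable 1-face and no removable 2-face). -/
theorem statement17 :
    NPM.IsPM B39 3 ∧ (NPM.verts B39).card = 9 ∧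
    ¬ NPM.Neighbourly B39 ∧
    (∀ u ∈ NPM.verts B39, ∀ v ∈ NPM.verts B39, u ≠ v →
      (({u, v} : Finset ℕ) ∉ B39 ↔ ({u, v} : Finset ℕ) = {7, 9})) ∧
    (∀ i : ℕ, 0 < i → i < 3 → ∀ A : Finset ℕ, ¬ NPM.RemovableFace 3 i B39 A) := by
  refine ⟨isPM_B39, by rw [verts_B39, Nat.card_Icc], not_neighbourly_B39, pair_notMem_B39_iff,
    fun i hi hi3 A => not_removableFace_B39 hi hi3 A⟩
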